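/- arXiv:2004.06942 — 2 statements merged into one kernel-verified Lean document; each statement's English description precedes it below -/
import Mathlib

section
/- Let d ≥ 1, let U ⊆ ℝ^d be a bounded open set, and let F : ℝ^d → ℝ^d be a continuous map that is a local homeomorphism (every point has an open neighborhood mapped homeomorphically onto an open set) and satisfies F(x) = x for every x ∈ ℝ^d \ U. Then U ⊆ F(U); in particular, if F is additionally injective, then F(U) = U and F restricted to U is a bijection from U onto U. -/
/-- An open continuous self-map of a connected proper metric space that is the identity off a
bounded open set is surjective. -/
theorem IsOpenMap.surjective_of_eqOn_id_compl {X : Type*} [PseudoMetricSpace X] [T2Space X]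
    [ProperSpace X] [ConnectedSpace X] {U : Set X} {F : X → X} (hF : IsOpenMap F)
    (hFcont : Continuous F) (hUopen : IsOpen U) (hUbdd : Bornology.IsBounded U)
    (hid : ∀ x ∉ U, F x = x) : Function.Surjective F := by
  have hrange : Set.range F = F '' closure U ∪ Uᶜ := by
    ext y
    constructor
    · rintro ⟨x, rfl⟩
      by_cases hx : x ∈ U
      · exact Or.inl ⟨x, subset_closure hx, rfl⟩
      · exact Or.inr (by rwa [hid x hx])
    · rintro (⟨x, -, rfl⟩ | hy)
      · exact ⟨x, rfl⟩
      · exact ⟨y, hid y hy⟩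
  have hclosed : IsClosed (Set.range F) := by
    rw [hrange]
    exact (hUbdd.isCompact_closure.image hFcont).isClosed.union hUopen.isClosed_compl
  exact Set.range_eq_univ.mp
    (IsClopen.eq_univ ⟨hclosed, hF.isOpen_range⟩ (Set.range_nonempty F))

theorem stmt_2 (d : ℕ) (hd : 1 ≤ d) (U : Set (EuclideanSpace ℝ (Fin d)))
    (hUopen : IsOpen U) (hUbdd : Bornology.IsBounded U)
    (F : EuclideanSpace ℝ (Fin d) → EuclideanSpace ℝ (Fin d))
    (hFcont : Continuous F)
    (hFloc : IsLocalHomeomorph F)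
    (hid : ∀ x ∉ U, F x = x) :
    U ⊆ F '' U ∧ (Function.Injective F → F '' U = U ∧ Set.BijOn F U U) := by
  have hsub : U ⊆ F '' U := by
    intro y hy
    obtain ⟨x, rfl⟩ :=
      hFloc.isOpenMap.surjective_of_eqOn_id_compl hFcont hUopen hUbdd hid y
    refine ⟨x, ?_, rfl⟩
    by_contra hx
    exact hx (hid x hx ▸ hy)
  refine ⟨hsub, fun hinj => ?_⟩
  have hmaps : Set.MapsTo F U U := by
    intro x hx
    by_contra hFx
    exact hFx ((hinj (hid (F x) hFx)).symm ▸ hx)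
  exact ⟨hmaps.image_subset.antisymm hsub, hmaps, hinj.injOn, hsub⟩
end

section
/- Let (X, μ) be a finite measure space and let 2 ≤ r < ∞. Define F : L^r(μ) → ℝ by F(q) = ½ ∫_X (q₊)² dμ, where q₊ = max(q, 0) denotes the pointwise positive part. Then F is Fréchet differentiable at every q ∈ L^r(μ), and its derivative is the bounded linear functional F′(q) : L^r(μ) → ℝ given by F′(q)h = ∫_X q₊ · h dμ. -/
open MeasureTheory
open scoped ENNReal

/-- The inclusion `L^p(μ) ⊆ L^q(μ)` for `q ≤ p` on a finite measure space, as a bounded operator. -/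
noncomputable def lpInclusion {X : Type*} [MeasurableSpace X] (μ : Measure X) [IsFiniteMeasure μ]
    {p q : ℝ≥0∞} [Fact (1 ≤ p)] [Fact (1 ≤ q)] (hqp : q ≤ p) : Lp ℝ p μ →L[ℝ] Lp ℝ q μ :=
  LinearMap.mkContinuous
    { toFun := fun f => ((Lp.memLp f).mono_exponent hqp).toLp f
      map_add' := fun f g => by
        rw [← MemLp.toLp_add]
        exact MemLp.toLp_congr _ _ (Lp.coeFn_add f g)
      map_smul' := fun c f => by
        rw [RingHom.id_apply, ← MemLp.toLp_const_smul]
        exact MemLp.toLp_congr _ _ (Lp.coeFn_smul c f) }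
    (μ Set.univ ^ (1 / q.toReal - 1 / p.toReal)).toReal
    fun f => by
      have hq : 1 ≤ q := Fact.out
      have hexp : 0 ≤ 1 / q.toReal - 1 / p.toReal := by
        rcases eq_or_ne p ⊤ with rfl | hp
        · simp
        · have hq_top : q ≠ ⊤ := ne_top_of_le_ne_top hp hqp
          have hq_pos : 0 < q.toReal :=
            ENNReal.toReal_pos (zero_lt_one.trans_le hq).ne' hq_top
          exact sub_nonneg.2 (one_div_le_one_div_of_le hq_pos (ENNReal.toReal_mono hp hqp))
      change ‖((Lp.memLp f).mono_exponent hqp).toLp f‖ ≤ _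
      rw [Lp.norm_toLp, Lp.norm_def, mul_comm, ← ENNReal.toReal_mul]
      exact ENNReal.toReal_mono
        (ENNReal.mul_ne_top (Lp.eLpNorm_ne_top f)
          (ENNReal.rpow_ne_top_of_nonneg hexp (measure_ne_top μ _)))
        (eLpNorm_le_eLpNorm_mul_rpow_measure_univ hqp (Lp.aestronglyMeasurable f))

theorem coeFn_lpInclusion {X : Type*} [MeasurableSpace X] (μ : Measure X) [IsFiniteMeasure μ]
    {p q : ℝ≥0∞} [Fact (1 ≤ p)] [Fact (1 ≤ q)] (hqp : q ≤ p) (f : Lp ℝ p μ) :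
    lpInclusion μ hqp f =ᵐ[μ] f :=
  MemLp.coeFn_toLp ((Lp.memLp f).mono_exponent hqp)

/-- The map `t ↦ t₊² / 2` has a first-order Taylor remainder of at most `b² / 2`. -/
theorem abs_half_sq_posPart_remainder_le (a b : ℝ) :
    |1 / 2 * max (a + b) 0 ^ 2 - 1 / 2 * max a 0 ^ 2 - max a 0 * b| ≤ 1 / 2 * b ^ 2 := by
  rw [abs_le]
  rcases max_cases (a + b) 0 with ⟨h₁, h₁'⟩ | ⟨h₁, h₁'⟩ <;>
  rcases max_cases a 0 with ⟨h₂, h₂'⟩ | ⟨h₂, h₂'⟩ <;>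
  rw [h₁, h₂] <;> constructor <;> nlinarith [sq_nonneg (a + b), sq_nonneg a, sq_nonneg b]

theorem stmt_10 {X : Type*} [MeasurableSpace X] (μ : Measure X)
    [IsFiniteMeasure μ] (r : ℝ≥0∞) [Fact (1 ≤ r)] (hr : 2 ≤ r) (hr' : r ≠ ⊤)
    (F : Lp ℝ r μ → ℝ)
    (hF : ∀ q : Lp ℝ r μ, F q = (1 / 2) * ∫ x, (max (q x) 0) ^ 2 ∂μ)
    (q : Lp ℝ r μ) :
    ∃ L : Lp ℝ r μ →L[ℝ] ℝ,
      (∀ h : Lp ℝ r μ, L h = ∫ x, max (q x) 0 * h x ∂μ) ∧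
      HasFDerivAt F L q := by
  have memLp_two (f : Lp ℝ r μ) : MemLp f 2 μ := (Lp.memLp f).mono_exponent hr
  have memLp_pos (f : Lp ℝ r μ) : MemLp (fun x => max (f x) 0) 2 μ := (memLp_two f).pos_part
  let ι : Lp ℝ r μ →L[ℝ] Lp ℝ 2 μ := lpInclusion μ hr
  have hι (f : Lp ℝ r μ) : ι f =ᵐ[μ] f := coeFn_lpInclusion μ hr f
  let L : Lp ℝ r μ →L[ℝ] ℝ := (innerSL ℝ ((memLp_pos q).toLp _)).comp ι
  have hL (h : Lp ℝ r μ) : L h = ∫ x, max (q x) 0 * h x ∂μ := by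
    change inner ℝ ((memLp_pos q).toLp _) (ι h) = _
    rw [L2.inner_def]
    refine integral_congr_ae ?_
    filter_upwards [(memLp_pos q).coeFn_toLp, hι h] with x hx hx'
    rw [hx, hx', real_inner_comm]
    rfl
  have norm_sq (h : Lp ℝ r μ) : ‖ι h‖ ^ 2 = ∫ x, h x ^ 2 ∂μ := by
    rw [← real_inner_self_eq_norm_sq, L2.inner_def]
    refine integral_congr_ae ?_
    filter_upwards [hι h] with x hx
    rw [hx, real_inner_self_eq_norm_sq, Real.norm_eq_abs, sq_abs]
  have remainder (h : Lp ℝ r μ) : ‖F (q + h) - F q - L h‖ ≤ 1 / 2 * ‖ι‖ ^ 2 * ‖h‖ ^ 2 := by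
    have int_add := (memLp_pos (q + h)).integrable_sq.const_mul (1 / 2)
    have int_q := (memLp_pos q).integrable_sq.const_mul (1 / 2)
    have int_mul : Integrable (fun x => max (q x) 0 * h x) μ :=
      (memLp_pos q).integrable_mul (memLp_two h)
    have int_sub : Integrable (fun x => 1 / 2 * max ((q + h) x) 0 ^ 2 - 1 / 2 * max (q x) 0 ^ 2) μ :=
      int_add.sub int_q
    calc ‖F (q + h) - F q - L h‖
        = ‖∫ x, (1 / 2 * max ((q + h) x) 0 ^ 2 - 1 / 2 * max (q x) 0 ^ 2
            - max (q x) 0 * h x) ∂μ‖ := by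
          rw [integral_sub int_sub int_mul, integral_sub int_add int_q,
            integral_const_mul, integral_const_mul, hF, hF, hL]
      _ ≤ ∫ x, 1 / 2 * h x ^ 2 ∂μ := by
          refine norm_integral_le_of_norm_le ((memLp_two h).integrable_sq.const_mul _) ?_
          filter_upwards [Lp.coeFn_add q h] with x hx
          rw [hx]
          exact abs_half_sq_posPart_remainder_le (q x) (h x)
      _ = 1 / 2 * ‖ι h‖ ^ 2 := by rw [integral_const_mul, norm_sq]
      _ ≤ 1 / 2 * (‖ι‖ * ‖h‖) ^ 2 := by gcongr; exact ι.le_opNorm h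
      _ = 1 / 2 * ‖ι‖ ^ 2 * ‖h‖ ^ 2 := by ring
  refine ⟨L, hL, hasFDerivAt_iff_isLittleO_nhds_zero.2 ?_⟩
  refine (Asymptotics.IsBigO.of_bound (1 / 2 * ‖ι‖ ^ 2) (.of_forall fun h => ?_)).trans_isLittleO
    (Asymptotics.isLittleO_norm_pow_id one_lt_two)
  simpa using remainder h
end
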